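/- arXiv:1703.03242 — 9 statements merged into one kernel-verified Lean document; each statement's English description precedes it below -/
import Mathlib

section
/- Let m be a positive integer and let W = (mℕ + X_m) ∪ Y⁰ ∪ Y¹, where X_m ⊆ {0,1,...,m-1}, Y⁰ is a finite set of negative integers with Y⁰ mod m ⊆ X_m, and Y¹ is a finite set of integers with (Y¹ mod m) ∩ X_m = ∅. If there exists a minimal additive complement to W in ℤ, then there exists a set C ⊆ {0,1,...,m-1} such that: (a) C + (X_m ∪ Y¹) mod m = {0,1,...,m-1}; and (b) for every c ∈ C there exists y ∈ Y¹ such that c + y ≢ c' + x (mod m) for every c' ∈ C and every x ∈ X_m. -/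
open Pointwise

/-- `mNX m X = {k*m + x : k ∈ ℕ, x ∈ X}`, i.e. `mℕ + X`. -/
def mNX (m : ℤ) (X : Set ℤ) : Set ℤ := {n : ℤ | ∃ k : ℕ, ∃ x ∈ X, n = (k : ℤ) * m + x}

/-- `modSet S m` is the set of residues of `S` modulo `m`, i.e. the set of
`r ∈ {0,1,…,m-1}` with `r ≡ s (mod m)` for some `s ∈ S` (for `m > 0`). -/
def modSet (S : Set ℤ) (m : ℤ) : Set ℤ := (fun s => s % m) '' S

/-- `A` is an additive complement to `B` in `ℤ`. -/
def IsComplement (A B : Set ℤ) : Prop := A + B = Set.univ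

/-- `A` is a minimal additive complement to `B` in `ℤ`. -/
def IsMinComplement (A B : Set ℤ) : Prop :=
  IsComplement A B ∧ ∀ A' ⊂ A, ¬ IsComplement A' B

/-- The residues `c` modulo `m` whose class meets `A` in a set that is unbounded below. -/
def lowResidues (m : ℤ) (A : Set ℤ) : Set ℤ :=
  {c | c ∈ Set.Ico 0 m ∧ ∀ N : ℤ, ∃ a ∈ A, a % m = c ∧ a < N}

theorem exists_forall_lt_emod_mem_lowResidues {m : ℤ} (hm : 0 < m) (A : Set ℤ) :
    ∃ N : ℤ, ∀ a ∈ A, a < N → a % m ∈ lowResidues m A := by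
  have h : ∀ c : ℤ, ∃ N : ℤ, c ∈ Set.Ico 0 m → c ∉ lowResidues m A →
      ∀ a ∈ A, a % m = c → N ≤ a := by
    intro c
    by_contra! hc
    obtain ⟨hcm, hcl, -⟩ := hc 0
    refine hcl ⟨hcm, fun N => ?_⟩
    obtain ⟨-, -, a, ha, hac, haN⟩ := hc N
    exact ⟨a, ha, hac, haN⟩
  choose f hf using h
  obtain ⟨N, hN⟩ := ((Set.finite_Ico (0 : ℤ) m).image f).bddBelow
  refine ⟨N, fun a ha haN => ?_⟩
  by_contra hc
  have hmem : a % m ∈ Set.Ico 0 m := ⟨Int.emod_nonneg a hm.ne', Int.emod_lt_of_pos a hm⟩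
  have h1 := hf (a % m) hmem hc a ha rfl
  have h2 := hN (Set.mem_image_of_mem f hmem)
  omega

theorem mem_mNX_of_modEq {m : ℤ} (hm : 0 < m) {X : Set ℤ} {x n : ℤ} (hx : x ∈ X)
    (hxn : x ≤ n) (h : n ≡ x [ZMOD m]) : n ∈ mNX m X := by
  obtain ⟨k, hk⟩ := h.symm.dvd
  have hk0 : 0 ≤ k := by
    by_contra! hneg
    nlinarith
  refine ⟨k.toNat, x, hx, ?_⟩
  rw [Int.toNat_of_nonneg hk0]
  linarith

theorem emod_mem_of_mem_mNX {m : ℤ} {X : Set ℤ} (hX : X ⊆ Set.Ico 0 m) {w : ℤ}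
    (hw : w ∈ mNX m X) : w % m ∈ X := by
  obtain ⟨k, x, hx, rfl⟩ := hw
  have h : ((k : ℤ) * m + x) % m = x := by
    rw [add_comm, Int.add_mul_emod_self_right, Int.emod_eq_of_lt (hX hx).1 (hX hx).2]
  rwa [h]

theorem bddBelow_mNX {m : ℤ} (hm : 0 < m) {X : Set ℤ} (hX : X ⊆ Set.Ico 0 m) :
    BddBelow (mNX m X) := by
  refine ⟨0, ?_⟩
  rintro w ⟨k, x, hx, rfl⟩
  have := (hX hx).1
  positivity

theorem IsMinComplement.exists_unique_summand {A B : Set ℤ} (h : IsMinComplement A B) {a : ℤ}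
    (ha : a ∈ A) : ∃ w ∈ B, ∀ a' ∈ A, a + w - a' ∈ B → a' = a := by
  have hnot := h.2 (A \ {a}) ⟨Set.sdiff_subset, fun hs => (hs ha).2 rfl⟩
  obtain ⟨n, hn⟩ := (Set.ne_univ_iff_exists_notMem _).1 hnot
  have hmem : n ∈ A + B := by rw [h.1]; trivial
  obtain ⟨b, hb, w, hw, rfl⟩ := Set.mem_add.1 hmem
  have huniq : ∀ a' ∈ A, b + w - a' ∈ B → a' = a := by
    intro a' ha' hB
    by_contra hne
    exact hn (Set.mem_add.2 ⟨a', ⟨ha', hne⟩, _, hB, by ring⟩)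
  obtain rfl := huniq b hb (by simpa using hw)
  exact ⟨w, hw, huniq⟩

theorem stmt_0 (m : ℤ) (hm : 0 < m) (Xm Y0 Y1 : Set ℤ)
    (hXm : Xm ⊆ Set.Ico 0 m)
    (hY0fin : Y0.Finite) (hY0neg : ∀ y ∈ Y0, y < 0)
    (hY0mod : modSet Y0 m ⊆ Xm)
    (hY1fin : Y1.Finite) (hY1mod : modSet Y1 m ∩ Xm = ∅)
    (hmin : ∃ A : Set ℤ, IsMinComplement A (mNX m Xm ∪ Y0 ∪ Y1)) :
    ∃ C ⊆ Set.Ico (0 : ℤ) m,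
      modSet (C + (Xm ∪ Y1)) m = Set.Ico (0 : ℤ) m ∧
      ∀ c ∈ C, ∃ y ∈ Y1, ∀ c' ∈ C, ∀ x ∈ Xm, ¬ (c + y ≡ c' + x [ZMOD m]) := by
  obtain ⟨A, hA⟩ := hmin
  have hmod : ∀ w ∈ mNX m Xm ∪ Y0, w % m ∈ Xm := by
    rintro w (hw | hw)
    · exact emod_mem_of_mem_mNX hXm hw
    · exact hY0mod (Set.mem_image_of_mem _ hw)
  refine ⟨lowResidues m A, fun c hc => hc.1, Set.Subset.antisymm ?_ ?_, ?_⟩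
  · rintro _ ⟨s, -, rfl⟩
    exact ⟨Int.emod_nonneg s hm.ne', Int.emod_lt_of_pos s hm⟩
  · intro r hr
    obtain ⟨N, hN⟩ := exists_forall_lt_emod_mem_lowResidues hm A
    obtain ⟨L, hL⟩ := ((bddBelow_mNX hm hXm).union hY0fin.bddBelow).union hY1fin.bddBelow
    obtain ⟨n, hn, hnr⟩ : ∃ n, n < N + L ∧ n % m = r := by
      refine ⟨r - m * (|r| + |N + L| + 1), ?_, ?_⟩
      · nlinarith [le_abs_self r, neg_abs_le (N + L), abs_nonneg r, abs_nonneg (N + L)]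
      · rw [Int.sub_mul_emod_self_left, Int.emod_eq_of_lt hr.1 hr.2]
    have hmem : n ∈ A + (mNX m Xm ∪ Y0 ∪ Y1) := by rw [hA.1]; trivial
    obtain ⟨a, ha, w, hw, rfl⟩ := Set.mem_add.1 hmem
    have haC := hN a ha (by have := hL hw; omega)
    rcases hw with hw | hw
    · refine ⟨a % m + w % m, Set.add_mem_add haC (Or.inl (hmod w hw)), ?_⟩
      simpa using hnr
    · refine ⟨a % m + w, Set.add_mem_add haC (Or.inr hw), ?_⟩
      simpa using hnr
  · intro c hc
    by_contra! hcon
    obtain ⟨a, ha, hac, -⟩ := hc.2 0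
    obtain ⟨w, hw, huniq⟩ := hA.exists_unique_summand ha
    obtain ⟨c', hc', x, hx, hcx⟩ : ∃ c' ∈ lowResidues m A, ∃ x ∈ Xm,
        c + w ≡ c' + x [ZMOD m] := by
      rcases hw with hw | hw
      · exact ⟨c, hc, w % m, hmod w hw, (Int.mod_modEq w m).symm.add_left c⟩
      · exact hcon w hw
    obtain ⟨a', ha', hac', hlt⟩ := hc'.2 (min a (a + w - x))
    refine (hlt.trans_le (min_le_left _ _)).ne (huniq a' ha' (Or.inl (Or.inl ?_)))
    refine mem_mNX_of_modEq hm hx ?_ ?_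
    · have := hlt.trans_le (min_le_right _ _)
      omega
    · have h1 : a ≡ c [ZMOD m] := hac ▸ (Int.mod_modEq a m).symm
      have h2 : a' ≡ c' [ZMOD m] := hac' ▸ (Int.mod_modEq a' m).symm
      simpa using ((h1.add_right w).trans hcx).sub h2
end

section
/- Let Y ⊆ 3ℕ + 1 (i.e., every element of Y is a nonnegative integer congruent to 1 modulo 3) and let W = 3ℕ ∪ Y. Then there does not exist a minimal additive complement to W in ℤ. -/
open Pointwise

/-- The members of `A` congruent to `r` modulo `3` are unbounded below. -/
def ResidueUnboundedBelow (A : Set ℤ) (r : ℤ) : Prop :=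
  ∀ n : ℤ, ∃ a ∈ A, a ≤ n ∧ a % 3 = r % 3

theorem residueUnboundedBelow_add_three {A : Set ℤ} {r : ℤ} :
    ResidueUnboundedBelow A (r + 3) ↔ ResidueUnboundedBelow A r := by
  simp [ResidueUnboundedBelow]

theorem IsComplement.residueUnboundedBelow_succ {A Y : Set ℤ} {r : ℤ}
    (hY : Y ⊆ {z : ℤ | ∃ k : ℕ, z = 3 * (k : ℤ) + 1})
    (hA : IsComplement A ({z : ℤ | ∃ k : ℕ, z = 3 * (k : ℤ)} ∪ Y))
    (hr : ¬ ResidueUnboundedBelow A r) : ResidueUnboundedBelow A (r + 1) := by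
  intro n
  unfold ResidueUnboundedBelow at hr
  push Not at hr
  obtain ⟨N, hN⟩ := hr
  obtain ⟨x, hxn, hxN, hx⟩ : ∃ x : ℤ, x ≤ n ∧ x ≤ N ∧ x % 3 = (r + 1) % 3 :=
    ⟨r + 1 - 3 * (|r + 1| + |n| + |N|), by grind, by grind, by omega⟩
  obtain ⟨a, ha, w, hw, rfl⟩ : x ∈ A + _ := hA ▸ Set.mem_univ x
  dsimp only at hxn hxN hx
  rcases hw with ⟨k, rfl⟩ | hw
  · exact ⟨a, ha, by omega, by omega⟩
  · obtain ⟨k, rfl⟩ := hY hw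
    exact absurd (show a % 3 = r % 3 by omega) (hN a ha (by omega))

theorem IsMinComplement.not_residueUnboundedBelow_succ {A Y : Set ℤ} {r : ℤ}
    (hY : Y ⊆ {z : ℤ | ∃ k : ℕ, z = 3 * (k : ℤ) + 1})
    (hA : IsMinComplement A ({z : ℤ | ∃ k : ℕ, z = 3 * (k : ℤ)} ∪ Y))
    (hr : ResidueUnboundedBelow A r) : ¬ ResidueUnboundedBelow A (r + 1) := by
  intro hs
  obtain ⟨a, ha, -, har⟩ := hr 0
  refine hA.2 (A \ {a}) (Set.sdiff_singleton_ssubset.2 ha) (Set.eq_univ_of_forall fun x => ?_)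
  have cover : ∀ t, ResidueUnboundedBelow A t → x % 3 = t % 3 →
      x ∈ A \ {a} + ({z : ℤ | ∃ k : ℕ, z = 3 * (k : ℤ)} ∪ Y) := by
    intro t ht hx
    obtain ⟨b, hb, hbx, hbt⟩ := ht (min x (a - 1))
    have hne : b ≠ a := by omega
    exact ⟨b, ⟨hb, hne⟩, x - b, Or.inl ⟨((x - b) / 3).toNat, by omega⟩, by simp⟩
  by_cases h0 : x % 3 = r % 3
  · exact cover r hr h0
  by_cases h1 : x % 3 = (r + 1) % 3
  · exact cover (r + 1) hs h1
  obtain ⟨b, hb, w, hw, rfl⟩ : x ∈ A + _ := hA.1 ▸ Set.mem_univ x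
  dsimp only at h0 h1
  refine ⟨b, ⟨hb, ?_⟩, w, hw, rfl⟩
  rintro rfl
  rcases hw with ⟨k, rfl⟩ | hw
  · omega
  · obtain ⟨k, rfl⟩ := hY hw
    omega

theorem stmt_2 (Y : Set ℤ) (hY : Y ⊆ {z : ℤ | ∃ k : ℕ, z = 3 * (k : ℤ) + 1}) :
    ¬ ∃ A : Set ℤ, IsMinComplement A ({z : ℤ | ∃ k : ℕ, z = 3 * (k : ℤ)} ∪ Y) := by
  rintro ⟨A, hA⟩
  have succ_iff : ∀ r, ResidueUnboundedBelow A (r + 1) ↔ ¬ ResidueUnboundedBelow A r := fun r =>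
    ⟨fun h h' => hA.not_residueUnboundedBelow_succ hY h' h,
      hA.1.residueUnboundedBelow_succ hY⟩
  have h0 := succ_iff 0
  have h1 := succ_iff (0 + 1)
  have h2 := succ_iff (0 + 1 + 1)
  have h3 := residueUnboundedBelow_add_three (A := A) (r := 0)
  norm_num at h0 h1 h2 h3
  tauto
end

section
/- Let m be a positive integer and let W = (mℕ + X_m) ∪ Y⁰, where X_m ⊆ {0,1,...,m-1} is nonempty and Y⁰ is a finite set of negative integers with Y⁰ mod m ⊆ X_m. Then there does not exist a minimal additive complement to W in ℤ. (In particular, a quasiperiodic set W ⊆ ℕ has no minimal complement.) -/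
open Pointwise

/-- Membership in `mNX` for a set of residues: being nonnegative with residue in `X`. -/
theorem mem_mNX_iff {m : ℤ} (hm : 0 < m) {X : Set ℤ} (hX : X ⊆ Set.Ico 0 m) {n : ℤ} :
    n ∈ mNX m X ↔ 0 ≤ n ∧ n % m ∈ X := by
  constructor
  · rintro ⟨k, x, hx, rfl⟩
    obtain ⟨h0, h1⟩ := hX hx
    refine ⟨by positivity, ?_⟩
    rwa [add_comm, Int.add_mul_emod_self_right, Int.emod_eq_of_lt h0 h1]
  · rintro ⟨h0, hx⟩
    refine ⟨(n / m).toNat, n % m, hx, ?_⟩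
    rw [Int.toNat_of_nonneg (Int.ediv_nonneg h0 hm.le), mul_comm]
    exact (Int.mul_ediv_add_emod n m).symm

/-- A set of integers that is unbounded below has two congruent elements arbitrarily far apart. -/
theorem exists_emod_eq_of_not_bddBelow {m : ℤ} (hm : 0 < m) {A : Set ℤ} (hA : ¬ BddBelow A)
    (L : ℤ) : ∃ a ∈ A, ∃ b ∈ A, b % m = a % m ∧ b < a + L := by
  by_contra! h
  refine hA (BddBelow.mono (t := ⋃ r ∈ Set.Ico 0 m, {a ∈ A | a % m = r}) ?_ ?_)
  · intro a ha
    simp only [Set.mem_iUnion]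
    exact ⟨a % m, ⟨Int.emod_nonneg _ hm.ne', Int.emod_lt_of_pos _ hm⟩, ha, rfl⟩
  · rw [(Set.finite_Ico 0 m).bddBelow_biUnion]
    intro r _
    by_cases hr : ∃ a ∈ A, a % m = r
    · obtain ⟨a, ha, rfl⟩ := hr
      exact ⟨a + L, fun b hb => h a ha b hb.1 hb.2⟩
    · exact ⟨0, fun b hb => (hr ⟨b, hb⟩).elim⟩

/-- In a minimal complement no translate `a + W` is contained in another one `b + W`. -/
theorem IsMinComplement.eq_of_translate_subset {A W : Set ℤ} (hA : IsMinComplement A W) {a b : ℤ}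
    (ha : a ∈ A) (hb : b ∈ A) (h : ∀ w ∈ W, a + w - b ∈ W) : a = b := by
  by_contra hab
  refine hA.2 (A \ {a}) ⟨Set.sdiff_subset, fun hs => (hs ha).2 rfl⟩ ?_
  refine Set.eq_univ_of_forall fun n => ?_
  obtain ⟨c, hc, w, hw, rfl⟩ := Set.mem_add.1 (hA.1.symm ▸ Set.mem_univ n : n ∈ A + W)
  by_cases hca : c = a
  · subst hca
    exact Set.mem_add.2 ⟨b, ⟨hb, fun h' => hab h'.symm⟩, _, h w hw, by ring⟩
  · exact Set.add_mem_add ⟨hc, hca⟩ hw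

theorem stmt_3 (m : ℤ) (hm : 0 < m) (Xm Y0 : Set ℤ)
    (hXm : Xm ⊆ Set.Ico 0 m) (hXne : Xm.Nonempty)
    (hY0fin : Y0.Finite) (hY0neg : ∀ y ∈ Y0, y < 0)
    (hY0mod : modSet Y0 m ⊆ Xm) :
    ¬ ∃ A : Set ℤ, IsMinComplement A (mNX m Xm ∪ Y0) := by
  rintro ⟨A, hA⟩
  have hW : ∀ w ∈ mNX m Xm ∪ Y0, w % m ∈ Xm := by
    rintro w (hw | hw)
    · exact ((mem_mNX_iff hm hXm).1 hw).2
    · exact hY0mod ⟨w, hw, rfl⟩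
  have hWb : BddBelow (mNX m Xm ∪ Y0) :=
    BddBelow.union ⟨0, fun w hw => ((mem_mNX_iff hm hXm).1 hw).1⟩ hY0fin.bddBelow
  have hAb : ¬ BddBelow A := fun h => by
    have hu := h.add hWb
    rw [hA.1] at hu
    exact not_bddBelow_univ hu
  obtain ⟨L, hL⟩ := hWb
  obtain ⟨a, ha, b, hb, hab, hlt⟩ := exists_emod_eq_of_not_bddBelow hm hAb (min L 0)
  have hL0 := min_le_left L 0
  have h0 := min_le_right L 0
  refine absurd (hA.eq_of_translate_subset ha hb fun w hw => Or.inl ?_) (by omega)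
  have hLw := hL hw
  refine (mem_mNX_iff hm hXm).2 ⟨by omega, ?_⟩
  have hmod : a + w - b ≡ w [ZMOD m] := by
    have := (Int.ModEq.add_right w (show a ≡ b [ZMOD m] from hab.symm)).sub_right b
    simpa using this
  rw [hmod]
  exact hW w hw
end

section
/- Let m be a positive integer and let W = (mℕ + X_m) ∪ Y⁰ ∪ Y¹, where X_m ⊆ {0,1,...,m-1}, Y⁰ is a finite set of negative integers with Y⁰ mod m ⊆ X_m, and Y¹ is a finite set of integers with (Y¹ mod m) ∩ X_m = ∅. Suppose there exists a set C ⊆ {0,1,...,m-1} such that: (a) C + (X_m ∪ Y¹) mod m = {0,1,...,m-1}; and (b) for every c ∈ C there exists y ∈ Y¹ such that c + y ≢ c' + x (mod m) for every c' ∈ C \ {c} and every x ∈ X_m ∪ Y¹. Then there exists a minimal additive complement to W in ℤ. -/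
open Pointwise

/-- In a nonempty chain of sets, finitely many points each missed by some member are missed by a
common member. -/
theorem exists_mem_chain_forall_notMem {α : Type*} {K : Set (Set α)}
    (hK : IsChain (· ⊆ ·) K) (hne : K.Nonempty) {F : Set α} (hF : F.Finite)
    (h : ∀ a ∈ F, ∃ A ∈ K, a ∉ A) : ∃ A ∈ K, ∀ a ∈ F, a ∉ A := by
  induction F, hF using Set.Finite.induction_on with
  | empty =>
    obtain ⟨A, hA⟩ := hne
    exact ⟨A, hA, by simp⟩
  | @insert a s _ _ ih =>
    obtain ⟨A, hA, hAs⟩ := ih fun b hb => h b (Set.mem_insert_of_mem _ hb)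
    obtain ⟨B, hB, haB⟩ := h a (Set.mem_insert _ _)
    rcases hK.total hA hB with hAB | hBA
    · refine ⟨A, hA, ?_⟩
      rintro b (rfl | hb)
      · exact fun hbA => haB (hAB hbA)
      · exact hAs b hb
    · refine ⟨B, hB, ?_⟩
      rintro b (rfl | hb)
      · exact haB
      · exact fun hbB => hAs b hb (hBA hbB)

/-- A finite set meeting every member of a nonempty chain of sets meets its intersection. -/
theorem exists_mem_sInter_of_chain {α : Type*} {K : Set (Set α)}
    (hK : IsChain (· ⊆ ·) K) (hne : K.Nonempty) {F : Set α} (hF : F.Finite)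
    (h : ∀ A ∈ K, ∃ a ∈ F, a ∈ A) : ∃ a ∈ F, a ∈ ⋂₀ K := by
  by_contra! hcon
  obtain ⟨A, hA, hAF⟩ := exists_mem_chain_forall_notMem hK hne hF fun a ha => by
    simpa using hcon a ha
  obtain ⟨a, ha, haA⟩ := h A hA
  exact hAF a ha haA

theorem stmt_4 (m : ℤ) (hm : 0 < m) (Xm Y0 Y1 : Set ℤ)
    (hXm : Xm ⊆ Set.Ico 0 m)
    (hY0fin : Y0.Finite) (hY0neg : ∀ y ∈ Y0, y < 0)
    (hY0mod : modSet Y0 m ⊆ Xm)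
    (hY1fin : Y1.Finite) (hY1mod : modSet Y1 m ∩ Xm = ∅)
    (C : Set ℤ) (hC : C ⊆ Set.Ico (0 : ℤ) m)
    (ha : modSet (C + (Xm ∪ Y1)) m = Set.Ico (0 : ℤ) m)
    (hb : ∀ c ∈ C, ∃ y ∈ Y1, ∀ c' ∈ C \ {c}, ∀ x ∈ Xm ∪ Y1,
      ¬ (c + y ≡ c' + x [ZMOD m])) :
    ∃ A : Set ℤ, IsMinComplement A (mNX m Xm ∪ Y0 ∪ Y1) := by
  have hW : ∀ w ∈ mNX m Xm ∪ Y0 ∪ Y1, w % m ∈ Xm ∨ w ∈ Y1 := by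
    rintro w ((⟨k, x, hx, rfl⟩ | hw) | hw)
    · left
      obtain ⟨h0, h1⟩ := hXm hx
      rwa [add_comm, Int.add_mul_emod_self_right, Int.emod_eq_of_lt h0 h1]
    · exact Or.inl (hY0mod ⟨w, hw, rfl⟩)
    · exact Or.inr hw
  set W := mNX m Xm ∪ Y0 ∪ Y1
  have hY1W : Y1 ⊆ W := Set.subset_union_right
  have hXW : ∀ k : ℤ, 0 ≤ k → ∀ x ∈ Xm, k * m + x ∈ W := fun k hk x hx =>
    Or.inl (Or.inl ⟨k.toNat, x, hx, by rw [Int.toNat_of_nonneg hk]⟩)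
  have hXY : Xm ∪ Y1 ⊆ W := Set.union_subset (fun x hx => by simpa using hXW 0 le_rfl x hx) hY1W
  have hCmod : ∀ c ∈ C, c % m = c := fun c hc => Int.emod_eq_of_lt (hC hc).1 (hC hc).2
  set S : Set (Set ℤ) := {A | (∀ a ∈ A, a % m ∈ C) ∧ A + W = Set.univ}
  have hfull : {a : ℤ | a % m ∈ C} ∈ S := by
    refine ⟨fun a h => h, Set.eq_univ_of_forall fun n => ?_⟩
    have hn : n % m ∈ Set.Ico 0 m := ⟨Int.emod_nonneg _ hm.ne', Int.emod_lt_of_pos _ hm⟩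
    rw [← ha] at hn
    obtain ⟨_, ⟨c, hc, x, hx, rfl⟩, h⟩ := hn
    refine ⟨n - x, ?_, x, hXY hx, by simp⟩
    have h' : c ≡ n - x [ZMOD m] := by
      have := Int.ModEq.sub_right x (show c + x ≡ n [ZMOD m] from h)
      simpa using this
    rw [Set.mem_ofPred_eq, ← h'.eq, hCmod c hc]
    exact hc
  have hchain : ∀ K ⊆ S, IsChain (· ⊆ ·) K → ∃ lb ∈ S, ∀ s ∈ K, lb ⊆ s := by
    intro K hKS hK
    rcases K.eq_empty_or_nonempty with rfl | hne
    · exact ⟨_, hfull, by simp⟩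
    have hres : ∀ a ∈ ⋂₀ K, a % m ∈ C := by
      obtain ⟨A, hA⟩ := hne
      exact fun a h => (hKS hA).1 a (h A hA)
    have hfin : ∀ n : ℤ, (∀ c ∈ C, ∀ x ∈ Xm, ¬ n ≡ c + x [ZMOD m]) →
        ∃ y ∈ Y1, n - y ∈ ⋂₀ K := by
      intro n hn
      have := exists_mem_sInter_of_chain hK hne (hY1fin.image (n - ·)) fun A hA => by
        obtain ⟨a, haA, w, hw, h⟩ : n ∈ A + W := by rw [(hKS hA).2]; trivial
        rcases hW w hw with hw | hw
        · refine absurd ?_ (hn _ ((hKS hA).1 a haA) _ hw)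
          rw [← h]
          exact (Int.ModEq.add (Int.mod_modEq a m) (Int.mod_modEq w m)).symm
        · refine ⟨a, ⟨w, hw, ?_⟩, haA⟩
          simp [← h]
      simpa using this
    refine ⟨⋂₀ K, ⟨hres, Set.eq_univ_of_forall fun n => ?_⟩, fun s hs => Set.sInter_subset_of_mem hs⟩
    by_cases hn : ∀ c ∈ C, ∀ x ∈ Xm, ¬ n ≡ c + x [ZMOD m]
    · obtain ⟨y, hy, hny⟩ := hfin n hn
      exact ⟨n - y, hny, y, hY1W hy, by simp⟩
    push Not at hn
    obtain ⟨c, hc, x, hx, hncx⟩ := hn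
    obtain ⟨y, hy, hyc⟩ := hb c hc
    obtain ⟨b, hbY⟩ := hY1fin.bddBelow
    set k : ℤ := |c + y - b - n + x|
    have hNmod : c + y - k * m ≡ c + y [ZMOD m] := by
      simp [Int.ModEq]
    obtain ⟨y', hy', hmem⟩ := hfin (c + y - k * m) fun c' hc' x' hx' h => by
      have h' := hNmod.symm.trans h
      by_cases hcc : c' = c
      · subst hcc
        have hyx : y % m = x' % m := Int.ModEq.add_left_cancel' c' h'
        rw [Int.emod_eq_of_lt (hXm hx').1 (hXm hx').2] at hyx
        exact (Set.eq_empty_iff_forall_notMem.1 hY1mod) x' ⟨⟨y, hy, hyx⟩, hx'⟩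
      · exact hyc c' ⟨hc', hcc⟩ x' (Or.inl hx') h'
    set a := c + y - k * m - y' with ha_def
    have hac : a % m = c := by
      by_contra hne'
      refine hyc (a % m) ⟨hres a hmem, hne'⟩ y' (Or.inr hy') ?_
      have h1 : a % m + y' ≡ a + y' [ZMOD m] := (Int.mod_modEq a m).add_right y'
      refine (h1.trans ?_).symm
      simpa [ha_def] using hNmod
    have hle : a + x ≤ n := by
      have h1 : c + y - b - n + x ≤ k := le_abs_self _
      have h2 : b ≤ y' := hbY hy'
      have h3 : k ≤ k * m := le_mul_of_one_le_right (abs_nonneg _) hm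
      linarith
    have hdvd : m ∣ n - (a + x) := by
      have h1 : a + x ≡ c + x [ZMOD m] := by
        refine Int.ModEq.add_right x ?_
        rw [← hac]
        exact (Int.mod_modEq a m).symm
      exact (h1.trans hncx.symm).dvd
    obtain ⟨j, hj⟩ := hdvd
    have hj0 : 0 ≤ j := by
      by_contra! hlt
      have := mul_neg_of_pos_of_neg hm hlt
      linarith
    exact ⟨a, hmem, j * m + x, hXW j hj0 x hx, by simp only; linarith⟩
  obtain ⟨A, hA⟩ := zorn_superset S hchain
  refine ⟨A, hA.prop.2, fun A' hA' hcomp => ?_⟩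
  exact hA'.2 (hA.le_of_le ⟨fun a h => hA.prop.1 a (hA'.1 h), hcomp⟩ hA'.1)
end

section
/- There exists an infinite set W ⊆ ℕ which is not eventually periodic, whose elements w₁ < w₂ < w₃ < ⋯ satisfy w_{i+1} − w_i ∈ {1, 2} for all i ≥ 1, and such that there exists a minimal additive complement to W in ℤ. -/
open Pointwise

/-- `X` is eventually periodic: there is a positive `T` such that `x + T ∈ X`
for all sufficiently large `x ∈ X`. -/
def EventuallyPeriodic (X : Set ℤ) : Prop :=
  ∃ T : ℤ, 0 < T ∧ ∃ N : ℤ, ∀ x ∈ X, N ≤ x → x + T ∈ X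

/-- The numbers `4 * 16 ^ l + 16 * 16 ^ i` with `l ≠ i`. -/
def offDiagonalSums : Set ℤ :=
  {v | ∃ i l : ℕ, l ≠ i ∧ v = 16 * 16 ^ i + 4 * 16 ^ l}

theorem sixteen_mul_pow_le {i j : ℕ} (h : i < j) : (16 : ℤ) * 16 ^ i ≤ 16 ^ j := by
  rw [mul_comm, ← pow_succ]
  exact pow_le_pow_right₀ (by norm_num) h

theorem even_of_mem_offDiagonalSums {v : ℤ} (hv : v ∈ offDiagonalSums) : Even v := by
  obtain ⟨i, l, -, rfl⟩ := hv
  exact ⟨8 * 16 ^ i + 2 * 16 ^ l, by ring⟩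

theorem diagonal_notMem_offDiagonalSums (i : ℕ) :
    (16 : ℤ) * 16 ^ i + 4 * 16 ^ i ∉ offDiagonalSums := by
  rintro ⟨j, l, hlj, h⟩
  have hi : (0 : ℤ) < 16 ^ i := by positivity
  have hj : (0 : ℤ) < 16 ^ j := by positivity
  have hl : (0 : ℤ) < 16 ^ l := by positivity
  rcases lt_trichotomy j i with hji | rfl | hji
  · have h₁ := sixteen_mul_pow_le hji
    rcases lt_trichotomy l i with hli | rfl | hli
    · have h₂ := sixteen_mul_pow_le hli
      omega
    · omega
    · have h₂ := sixteen_mul_pow_le hli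
      omega
  · rcases lt_or_gt_of_ne hlj with hli | hli
    · have h₂ := sixteen_mul_pow_le hli
      omega
    · have h₂ := sixteen_mul_pow_le hli
      omega
  · have h₁ := sixteen_mul_pow_le hji
    omega

theorem exists_eq_of_add_mem_offDiagonalSums {n : ℤ} {k : ℕ} (hn : |n| < 16 ^ k)
    (h : n + 4 * 16 ^ k ∈ offDiagonalSums) : ∃ i : ℕ, n = 16 * 16 ^ i := by
  obtain ⟨i, l, -, h⟩ := h
  obtain ⟨hn₁, hn₂⟩ := abs_lt.mp hn
  have hi : (0 : ℤ) < 16 ^ i := by positivity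
  have hl : (0 : ℤ) < 16 ^ l := by positivity
  rcases lt_trichotomy l k with hlk | rfl | hlk
  · have h₁ := sixteen_mul_pow_le hlk
    rcases lt_or_ge i k with hik | hik
    · have h₂ := sixteen_mul_pow_le hik
      omega
    · have h₂ : (16 : ℤ) ^ k ≤ 16 ^ i := pow_le_pow_right₀ (by norm_num) hik
      omega
  · exact ⟨i, by omega⟩
  · have h₁ := sixteen_mul_pow_le hlk
    omega

theorem exists_lt_sixteen_pow (m : ℤ) : ∃ k : ℕ, k ≠ 0 ∧ m < 16 ^ k := by
  obtain ⟨k, hk⟩ := pow_unbounded_of_one_lt m (by norm_num : (1 : ℤ) < 16)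
  exact ⟨k + 1, k.succ_ne_zero, hk.trans_le (pow_le_pow_right₀ (by norm_num) k.le_succ)⟩

theorem not_eventuallyPeriodic_diff_offDiagonalSums :
    ¬ EventuallyPeriodic ({z : ℤ | 0 ≤ z} \ offDiagonalSums) := by
  rintro ⟨T, hT, N, h⟩
  obtain ⟨k, hk, hlt⟩ := exists_lt_sixteen_pow (|16 - T| + |N|)
  have hN := le_abs_self N
  have hN₀ := abs_nonneg N
  have hT₁ := neg_abs_le (16 - T)
  have hmem : 16 - T + 4 * 16 ^ k ∈ {z : ℤ | 0 ≤ z} \ offDiagonalSums := by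
    refine ⟨?_, fun hv => ?_⟩
    · change 0 ≤ 16 - T + 4 * 16 ^ k
      linarith [abs_nonneg (16 - T)]
    · obtain ⟨i, hi⟩ := exists_eq_of_add_mem_offDiagonalSums (by linarith) hv
      have : (1 : ℤ) ≤ 16 ^ i := one_le_pow₀ (by norm_num)
      omega
  exact (h _ hmem (by linarith [abs_nonneg (16 - T)])).2 ⟨0, k, hk, by ring⟩

theorem isMinComplement_diff_offDiagonalSums :
    IsMinComplement (Set.range fun k : ℕ => -(4 * 16 ^ k : ℤ))
      ({z : ℤ | 0 ≤ z} \ offDiagonalSums) := by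
  refine ⟨Set.eq_univ_of_forall fun z => ?_, fun A' hA' hc => ?_⟩
  · obtain ⟨k, -, hk⟩ := exists_lt_sixteen_pow |z|
    by_cases hv : z + 4 * 16 ^ k ∈ offDiagonalSums
    · obtain ⟨i, rfl⟩ := exists_eq_of_add_mem_offDiagonalSums hk hv
      refine Set.mem_add.mpr ⟨_, ⟨i, rfl⟩, 16 * 16 ^ i + 4 * 16 ^ i,
        ⟨?_, diagonal_notMem_offDiagonalSums i⟩, by ring⟩
      change (0 : ℤ) ≤ 16 * 16 ^ i + 4 * 16 ^ i
      positivity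
    · refine Set.mem_add.mpr ⟨_, ⟨k, rfl⟩, z + 4 * 16 ^ k, ⟨?_, hv⟩, by ring⟩
      change 0 ≤ z + 4 * 16 ^ k
      linarith [neg_abs_le z, abs_nonneg z]
  · obtain ⟨hsub, hne⟩ := hA'
    obtain ⟨_, ⟨i, rfl⟩, hi⟩ := Set.not_subset.mp hne
    have hmem : (16 * 16 ^ i : ℤ) ∈ A' + ({z : ℤ | 0 ≤ z} \ offDiagonalSums) :=
      hc ▸ Set.mem_univ _
    obtain ⟨a, ha, w, hw, haw⟩ := Set.mem_add.mp hmem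
    obtain ⟨l, rfl⟩ := hsub ha
    refine hw.2 ⟨i, l, ?_, by linarith⟩
    rintro rfl
    exact hi ha

theorem stmt_7 :
    ∃ W : Set ℤ, W ⊆ {z : ℤ | 0 ≤ z} ∧ W.Infinite ∧ ¬ EventuallyPeriodic W ∧
      (∀ w ∈ W, w + 1 ∈ W ∨ w + 2 ∈ W) ∧
      ∃ A : Set ℤ, IsMinComplement A W := by
  refine ⟨{z : ℤ | 0 ≤ z} \ offDiagonalSums, Set.sdiff_subset, ?_,
    not_eventuallyPeriodic_diff_offDiagonalSums, fun w hw => ?_,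
    _, isMinComplement_diff_offDiagonalSums⟩
  · refine Set.infinite_of_injective_forall_mem (f := fun n : ℕ => (2 * n + 1 : ℤ))
      (fun a b hab => by simpa using hab) fun n => ⟨?_, fun hv => ?_⟩
    · change (0 : ℤ) ≤ 2 * n + 1
      positivity
    · obtain ⟨r, hr⟩ := even_of_mem_offDiagonalSums hv
      omega
  · have hw₀ : 0 ≤ w := hw.1
    by_cases h₁ : w + 1 ∈ offDiagonalSums
    · refine Or.inr ⟨show 0 ≤ w + 2 by omega, fun h₂ => ?_⟩
      obtain ⟨r, hr⟩ := even_of_mem_offDiagonalSums h₁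
      obtain ⟨s, hs⟩ := even_of_mem_offDiagonalSums h₂
      omega
    · exact Or.inl ⟨show 0 ≤ w + 1 by omega, h₁⟩
end

section
/- There exists an infinite set W ⊆ ℕ which is not eventually periodic, whose elements w₁ < w₂ < w₃ < ⋯ satisfy w_{i+1} − w_i ∈ {1, 2, 3} for all i ≥ 1, and such that there does not exist a minimal additive complement to W in ℤ. -/
open Pointwise

/-- Two powers of two that differ by `d > 0`: the smaller one is at most `d`. -/
lemma two_pow_le_of_add_eq_two_pow {i j : ℕ} {d : ℤ} (hd : 0 < d)
    (h : (2 : ℤ) ^ (i + 1) + d = 2 ^ (j + 1)) : (2 : ℤ) ^ (i + 1) ≤ d := by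
  have hlt : i + 1 < j + 1 := by
    rw [← pow_lt_pow_iff_right₀ (one_lt_two : (1 : ℤ) < 2)]
    omega
  have hle : (2 : ℤ) ^ (i + 1 + 1) ≤ 2 ^ (j + 1) := pow_le_pow_right₀ one_le_two hlt
  rw [pow_succ _ (i + 1)] at hle
  omega

/-- The nonnegative integers that are not of the form `2 ^ (k + 1)`. -/
def nonTwoPow : Set ℤ := {z | 0 ≤ z ∧ ∀ k : ℕ, z ≠ 2 ^ (k + 1)}

lemma exists_two_pow_of_notMem {z : ℤ} (hz : 0 ≤ z) (h : z ∉ nonTwoPow) :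
    ∃ k : ℕ, z = 2 ^ (k + 1) := by
  by_contra! hk
  exact h ⟨hz, hk⟩

lemma odd_mem_nonTwoPow {z : ℤ} (hz : 0 ≤ z) (h : z % 2 = 1) : z ∈ nonTwoPow := by
  refine ⟨hz, fun k hk => ?_⟩
  rw [pow_succ] at hk
  omega

lemma le_of_notMem_of_add_notMem {v d : ℤ} (hv : 0 ≤ v) (hd : 0 < d) (h : v ∉ nonTwoPow)
    (h' : v + d ∉ nonTwoPow) : v ≤ d := by
  obtain ⟨i, rfl⟩ := exists_two_pow_of_notMem hv h
  obtain ⟨j, hj⟩ := exists_two_pow_of_notMem (by omega) h'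
  exact two_pow_le_of_add_eq_two_pow hd hj

lemma not_eventuallyPeriodic_nonTwoPow : ¬ EventuallyPeriodic nonTwoPow := by
  rintro ⟨T, hT, N, h⟩
  obtain ⟨k, hk⟩ := pow_unbounded_of_one_lt (2 * T + |N|) (one_lt_two : (1 : ℤ) < 2)
  have hk' : (2 : ℤ) ^ k ≤ 2 ^ (k + 1) := pow_le_pow_right₀ one_le_two k.le_succ
  have hN := le_abs_self N
  have hN' := abs_nonneg N
  have hnot : (2 : ℤ) ^ (k + 1) - T + T ∉ nonTwoPow := fun hm => hm.2 k (by ring)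
  by_cases hx : (2 : ℤ) ^ (k + 1) - T ∈ nonTwoPow
  · exact hnot (h _ hx (by omega))
  · have := le_of_notMem_of_add_notMem (by omega) hT hx hnot
    omega

/-- Each element of a minimal complement is the only one representing some integer. -/
lemma IsMinComplement.exists_private {A B : Set ℤ} (h : IsMinComplement A B) {a : ℤ}
    (ha : a ∈ A) : ∃ n, n - a ∈ B ∧ ∀ a' ∈ A, a' ≠ a → n - a' ∉ B := by
  have hss : A \ {a} ⊂ A := Set.sdiff_singleton_ssubset.2 ha
  obtain ⟨n, hn⟩ := (Set.ne_univ_iff_exists_notMem _).1 (h.2 _ hss)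
  have hpriv : ∀ a' ∈ A, a' ≠ a → n - a' ∉ B := fun a' ha' hne hb =>
    hn (Set.mem_add.2 ⟨a', ⟨ha', hne⟩, n - a', hb, by ring⟩)
  have hmem : n ∈ A + B := by rw [h.1]; trivial
  obtain ⟨x, hx, b, hb, rfl⟩ := Set.mem_add.1 hmem
  refine ⟨x + b, ?_, hpriv⟩
  by_cases hxa : x = a
  · simpa [← hxa] using hb
  · exact absurd (by simpa using hb) (hpriv x hx hxa)

lemma IsComplement.exists_le {A B : Set ℤ} (h : IsComplement A B) (hB : ∀ b ∈ B, 0 ≤ b)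
    (m : ℤ) : ∃ a ∈ A, a ≤ m := by
  have hmem : m ∈ A + B := by rw [h]; trivial
  obtain ⟨a, ha, b, hb, rfl⟩ := Set.mem_add.1 hmem
  exact ⟨a, ha, by linarith [hB b hb]⟩

lemma not_isMinComplement_nonTwoPow (A : Set ℤ) : ¬ IsMinComplement A nonTwoPow := by
  intro h
  have hunb := h.1.exists_le fun b hb => hb.1
  obtain ⟨a, ha, -⟩ := hunb 0
  obtain ⟨b, hb, hba⟩ := hunb (a - 1)
  obtain ⟨n, hna, hn⟩ := h.exists_private ha
  obtain ⟨m, -, hm⟩ := h.exists_private hb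
  have hne : n ≠ m := by
    rintro rfl
    exact hm a ha (by omega) hna
  obtain ⟨c, hc, hcle⟩ := hunb (min (b - 1) (min n m - |n - m| - 1))
  have hnm := le_abs_self (n - m)
  have hmn := neg_abs_le (n - m)
  have hmin := min_le_left n m
  have hmin' := min_le_right n m
  have hcb := hcle.trans (min_le_left _ _)
  have hcn := hcle.trans (min_le_right _ _)
  have hnc := hn c hc (by omega)
  have hmc := hm c hc (by omega)
  rcases lt_or_gt_of_ne hne with hlt | hlt
  · have := le_of_notMem_of_add_notMem (v := n - c) (d := m - n) (by omega) (by omega) hnc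
      (by rwa [show n - c + (m - n) = m - c by ring])
    omega
  · have := le_of_notMem_of_add_notMem (v := m - c) (d := n - m) (by omega) (by omega) hmc
      (by rwa [show m - c + (n - m) = n - c by ring])
    omega

theorem stmt_8 :
    ∃ W : Set ℤ, W ⊆ {z : ℤ | 0 ≤ z} ∧ W.Infinite ∧ ¬ EventuallyPeriodic W ∧
      (∀ w ∈ W, w + 1 ∈ W ∨ w + 2 ∈ W ∨ w + 3 ∈ W) ∧
      ¬ ∃ A : Set ℤ, IsMinComplement A W := by
  refine ⟨nonTwoPow, fun z hz => hz.1, ?_, not_eventuallyPeriodic_nonTwoPow, fun w hw => ?_,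
    fun ⟨A, hA⟩ => not_isMinComplement_nonTwoPow A hA⟩
  · refine Set.infinite_of_injective_forall_mem (f := fun n : ℕ => 2 * (n : ℤ) + 1)
      (fun x y hxy => ?_) fun n => odd_mem_nonTwoPow (by omega) (by omega)
    simpa using hxy
  · have hw0 := hw.1
    rcases Int.emod_two_eq_zero_or_one w with h | h
    · exact Or.inl (odd_mem_nonTwoPow (by omega) (by omega))
    · exact Or.inr (Or.inl (odd_mem_nonTwoPow (by omega) (by omega)))
end

section
/- Let m be a positive integer and let W = (mℕ + X_m) ∪ Y⁰ ∪ Y¹, where X_m ⊆ {0,1,...,m-1}, Y⁰ is a finite set of negative integers with Y⁰ mod m ⊆ X_m, and Y¹ is a finite set of integers with (Y¹ mod m) ∩ X_m = ∅. Let D ⊆ ℤ be any additive complement to W (that is, D + W = ℤ), and define C = {j ∈ {0,1,...,m-1} : infinitely many negative integers d ∈ D satisfy d ≡ j (mod m)}. Then C + (X_m ∪ Y¹) mod m = {0,1,...,m-1}. -/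
open Pointwise

/-- All but finitely many negative elements of `D` lie in residue classes modulo `m` that contain
infinitely many negative elements of `D`. -/
theorem exists_bound_infinite_residue (m : ℤ) (hm : 0 < m) (D : Set ℤ) :
    ∃ b : ℤ, ∀ d ∈ D, d < 0 → d < b →
      {e ∈ D | e < 0 ∧ e ≡ d % m [ZMOD m]}.Infinite := by
  have hfin : (⋃ j ∈ {j ∈ Set.Ico (0 : ℤ) m | {e ∈ D | e < 0 ∧ e ≡ j [ZMOD m]}.Finite},
      {e ∈ D | e < 0 ∧ e ≡ j [ZMOD m]}).Finite :=
    ((Set.finite_Ico 0 m).subset (Set.sep_subset _ _)).biUnion fun j hj => hj.2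
  obtain ⟨b, hb⟩ := hfin.bddBelow
  refine ⟨b, fun d hdD hd0 hdb hd => ?_⟩
  refine hdb.not_ge (hb (Set.mem_biUnion (x := d % m) ⟨⟨?_, ?_⟩, hd⟩ ⟨hdD, hd0, ?_⟩))
  · exact Int.emod_nonneg d hm.ne'
  · exact Int.emod_lt_of_pos d hm
  · exact (Int.mod_modEq d m).symm

/-- If `X`, `Y0` and `Y1` are bounded below then so is `(mℕ + X) ∪ Y0 ∪ Y1`. -/
theorem bddBelow_mNX_union {m : ℤ} (hm : 0 ≤ m) {X Y0 Y1 : Set ℤ} (hX : BddBelow X)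
    (hY0 : BddBelow Y0) (hY1 : BddBelow Y1) : BddBelow (mNX m X ∪ Y0 ∪ Y1) := by
  refine BddBelow.union (BddBelow.union ?_ hY0) hY1
  obtain ⟨b, hb⟩ := hX
  refine ⟨b, ?_⟩
  rintro _ ⟨k, x, hx, rfl⟩
  have := hb hx
  have : 0 ≤ (k : ℤ) * m := by positivity
  lia

/-- Every element of `(mℕ + X) ∪ Y0 ∪ Y1` is congruent modulo `m` to an element of `X ∪ Y1`,
provided the residues of `Y0` lie in `X`. -/
theorem exists_modEq_of_mem_mNX_union {m : ℤ} {X Y0 Y1 : Set ℤ} (hY0 : modSet Y0 m ⊆ X)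
    {w : ℤ} (hw : w ∈ mNX m X ∪ Y0 ∪ Y1) : ∃ u ∈ X ∪ Y1, u ≡ w [ZMOD m] := by
  rcases hw with (⟨k, x, hx, rfl⟩ | hw) | hw
  · exact ⟨x, Or.inl hx, by simp [Int.ModEq]⟩
  · exact ⟨w % m, Or.inl (hY0 ⟨w, hw, rfl⟩), Int.mod_modEq w m⟩
  · exact ⟨w, Or.inr hw, rfl⟩

theorem stmt_9 (m : ℤ) (hm : 0 < m) (Xm Y0 Y1 D : Set ℤ)
    (hXm : Xm ⊆ Set.Ico 0 m)
    (hY0fin : Y0.Finite) (hY0neg : ∀ y ∈ Y0, y < 0)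
    (hY0mod : modSet Y0 m ⊆ Xm)
    (hY1fin : Y1.Finite) (hY1mod : modSet Y1 m ∩ Xm = ∅)
    (hD : IsComplement D (mNX m Xm ∪ Y0 ∪ Y1)) :
    modSet
      ({j ∈ Set.Ico (0 : ℤ) m | {d ∈ D | d < 0 ∧ d ≡ j [ZMOD m]}.Infinite}
        + (Xm ∪ Y1)) m = Set.Ico (0 : ℤ) m := by
  apply Set.Subset.antisymm
  · rintro _ ⟨s, -, rfl⟩
    exact ⟨Int.emod_nonneg s hm.ne', Int.emod_lt_of_pos s hm⟩
  rintro r ⟨hr0, hrm⟩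
  obtain ⟨b, hb⟩ := exists_bound_infinite_residue m hm D
  obtain ⟨l, hl⟩ := bddBelow_mNX_union hm.le (bddBelow_Ico.mono hXm) hY0fin.bddBelow
    hY1fin.bddBelow
  obtain ⟨k, hk⟩ : ∃ k : ℤ, r - k * m - l < min 0 b := by
    refine ⟨|r - l| + |min 0 b| + 1, ?_⟩
    have h₁ := le_abs_self (r - l)
    have h₂ := neg_abs_le (min 0 b)
    have h₃ : 0 ≤ |r - l| + |min 0 b| + 1 := by positivity
    nlinarith
  obtain ⟨d, hdD, w, hw, hdw⟩ : r - k * m ∈ D + (mNX m Xm ∪ Y0 ∪ Y1) := by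
    rw [show D + (mNX m Xm ∪ Y0 ∪ Y1) = Set.univ from hD]
    trivial
  replace hdw : d + w = r - k * m := hdw
  have hlw : l ≤ w := hl hw
  obtain ⟨u, hu, huw⟩ := exists_modEq_of_mem_mNX_union hY0mod hw
  refine ⟨d % m + u, Set.add_mem_add ⟨⟨Int.emod_nonneg d hm.ne', Int.emod_lt_of_pos d hm⟩,
    hb d hdD (by lia) (by lia)⟩ hu, ?_⟩
  have h : d % m + u ≡ d + w [ZMOD m] := (Int.mod_modEq d m).add huw
  rw [hdw] at h
  have h' : r - k * m ≡ r [ZMOD m] := by simp [Int.ModEq]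
  exact Eq.trans (h.trans h') (Int.emod_eq_of_lt hr0 hrm)
end

section
/- Let W be a nonempty finite set of integers. Then every additive complement to W in ℤ contains a minimal additive complement to W. -/
open Pointwise

/-- In a nonempty chain `c` of sets, some member meets a given finite set only in points of the
intersection of `c`. -/
theorem IsChain.exists_mem_forall_finite {α : Type*} {c : Set (Set α)}
    (hc : IsChain (· ⊆ ·) c) (hne : c.Nonempty) {F : Set α} (hF : F.Finite) :
    ∃ C ∈ c, ∀ x ∈ F, x ∈ C → x ∈ ⋂₀ c := by
  induction F, hF using Set.Finite.induction_on with
  | empty => exact ⟨hne.some, hne.some_mem, by simp⟩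
  | @insert a s _ _ ih =>
    obtain ⟨C, hC, h⟩ := ih
    by_cases ha : a ∈ ⋂₀ c
    · refine ⟨C, hC, ?_⟩
      rintro x (rfl | hx) hxC
      exacts [ha, h x hx hxC]
    · obtain ⟨D, hD, haD⟩ : ∃ D ∈ c, a ∉ D := by simpa using ha
      rcases hc.total hC hD with hCD | hDC
      · refine ⟨C, hC, ?_⟩
        rintro x (rfl | hx) hxC
        exacts [absurd (hCD hxC) haD, h x hx hxC]
      · refine ⟨D, hD, ?_⟩
        rintro x (rfl | hx) hxD
        exacts [absurd hxD haD, h x hx (hDC hxD)]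

/-- The intersection of a nonempty chain of complements to a finite set is a complement. -/
theorem IsComplement.sInter_of_isChain {W : Set ℤ} (hW : W.Finite) {c : Set (Set ℤ)}
    (hc : IsChain (· ⊆ ·) c) (hne : c.Nonempty) (h : ∀ C ∈ c, IsComplement C W) :
    IsComplement (⋂₀ c) W := by
  refine Set.eq_univ_of_forall fun z => ?_
  obtain ⟨C, hC, hCz⟩ := hc.exists_mem_forall_finite hne (hW.image (z - ·))
  obtain ⟨a, ha, w, hw, rfl⟩ : z ∈ C + W := (h C hC).symm ▸ Set.mem_univ z
  exact ⟨a, hCz a ⟨w, hw, by simp⟩ ha, w, hw, rfl⟩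

theorem stmt_10 (W : Set ℤ) (hWfin : W.Finite) (hWne : W.Nonempty)
    (A : Set ℤ) (hA : IsComplement A W) :
    ∃ A' ⊆ A, IsMinComplement A' W := by
  obtain ⟨M, hMA, hM⟩ := zorn_superset_nonempty {C | IsComplement C W}
    (fun c hcS hc hne => ⟨⋂₀ c, IsComplement.sInter_of_isChain hWfin hc hne hcS,
      fun _ hs => Set.sInter_subset_of_mem hs⟩) A hA
  exact ⟨M, hMA, hM.prop, fun B hB hBW => hB.not_subset (hM.2 hBW hB.subset)⟩
end

section
/- Let Y ⊆ ℤ be a nonempty finite set and let C', S ⊆ ℤ be sets with C' + Y ⊇ S. Then there exists a subset D' ⊆ C' such that D' + Y ⊇ S and, for every d ∈ D', (D' \ {d}) + Y does not contain S. -/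
open Pointwise

/-- The intersection of a nonempty chain of sets that all cover `S` after adding a finite set `Y`
still covers `S` after adding `Y`. -/
theorem subset_sInter_add_of_isChain {G : Type*} [AddGroup G] {Y S : Set G} (hY : Y.Finite)
    {c : Set (Set G)} (hc : IsChain (· ⊆ ·) c) (hne : c.Nonempty) (hcov : ∀ E ∈ c, S ⊆ E + Y) :
    S ⊆ ⋂₀ c + Y := by
  intro s hs
  by_contra hcon
  have hmiss : ∀ y ∈ Y, ∃ E ∈ c, s - y ∉ E := by
    intro y hy
    by_contra! hall
    exact hcon ⟨s - y, Set.mem_sInter.2 hall, y, hy, sub_add_cancel s y⟩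
  choose! E hEc hE using hmiss
  have hYne : Y.Nonempty := by
    obtain ⟨F, hF⟩ := hne
    obtain ⟨-, -, y, hy, -⟩ := hcov F hF hs
    exact ⟨y, hy⟩
  obtain ⟨F, hF⟩ := (hY.image E).exists_minimal (hYne.image E)
  obtain ⟨y₀, hy₀, rfl⟩ := hF.prop
  obtain ⟨x, hx, y, hy, rfl⟩ := hcov _ (hEc y₀ hy₀) hs
  have hle : E y₀ ⊆ E y := by
    rcases hc.total (hEc y₀ hy₀) (hEc y hy) with hsub | hsub
    · exact hsub
    · exact hF.le_of_le (Set.mem_image_of_mem E hy) hsub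
  exact hE y hy (by simpa using hle hx)

theorem stmt_11 (Y C' S : Set ℤ) (hYfin : Y.Finite) (hYne : Y.Nonempty)
    (h : S ⊆ C' + Y) :
    ∃ D' ⊆ C', S ⊆ D' + Y ∧ ∀ d ∈ D', ¬ S ⊆ (D' \ {d}) + Y := by
  obtain ⟨D, hDC, hD⟩ := zorn_superset_nonempty {E : Set ℤ | S ⊆ E + Y}
    (fun c hcov hc hne => ⟨⋂₀ c, subset_sInter_add_of_isChain hYfin hc hne hcov,
      fun _ hE => Set.sInter_subset_of_mem hE⟩) C' h
  exact ⟨D, hDC, hD.prop, fun d hd hcov => (hD.le_of_le hcov Set.sdiff_subset hd).2 rfl⟩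
end
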